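/- arXiv:math/0407220 — 2 statements merged into one kernel-verified Lean document; each statement's English description precedes it below -/
import Mathlib

section
/- Let H be a complex Hilbert space, A a norm-closed *-subalgebra of B(H), and X a norm-closed linear subspace of B(H) such that a x ∈ X for all a ∈ A and x ∈ X, and such that the linear span of {a x : a ∈ A, x ∈ X} is norm-dense in X (i.e., X is a nondegenerate concrete operator A-module). Let Y ⊆ X be a norm-closed subspace with a y ∈ Y for all a ∈ A, y ∈ Y, and let Φ : X → X be a linear map with ‖Φ‖ ≤ 1, Φ ∘ Φ = Φ, and range equal to Y. Then Φ(a x) = a Φ(x) for all a ∈ A and x ∈ X. -/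
section CommutingProjection

variable {A X : Type*} [CStarAlgebra A] [NormedAddCommGroup X] [NormedSpace ℂ X]
  [Module A X] [IsScalarTower ℂ A X]

/-- For `b = f(a)` with `0 ≤ f ≤ 1` and `t ≥ 0`, one has `(1 + t) ‖b z‖ ≤ ‖z + t b z‖`. -/
theorem one_add_mul_norm_cfc_smul_le (hsmul : ∀ (a : A) (x : X), ‖a • x‖ ≤ ‖a‖ * ‖x‖)
    (a : A) (ha : IsSelfAdjoint a) (f : ℝ → ℝ) (hf : Continuous f)
    (hf01 : ∀ s, f s ∈ Set.Icc (0 : ℝ) 1) (t : ℝ) (ht : 0 ≤ t) (z : X) :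
    (1 + t) * ‖cfc f a • z‖ ≤ ‖z + (t : ℂ) • cfc f a • z‖ := by
  have hpos (s : ℝ) : 0 < 1 + t * f s := by have := mul_nonneg ht (hf01 s).1; linarith
  set g : ℝ → ℝ := fun s ↦ (1 + t) * f s / (1 + t * f s)
  have hg : Continuous g := by
    refine Continuous.div (by fun_prop) (by fun_prop) fun s ↦ (hpos s).ne'
  have hg1 : ‖cfc g a‖ ≤ 1 := by
    refine norm_cfc_le zero_le_one fun s _ ↦ ?_
    obtain ⟨h0, h1⟩ := hf01 s
    rw [Real.norm_of_nonneg (div_nonneg (by positivity) (hpos s).le), div_le_one (hpos s)]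
    linarith
  have hmul : cfc g a * (1 + (t : ℂ) • cfc f a) = ((1 + t : ℝ) : ℂ) • cfc f a := by
    rw [Complex.coe_smul, Complex.coe_smul, ← cfc_smul t f a (by fun_prop),
      ← cfc_smul (1 + t) f a (by fun_prop), ← cfc_one ℝ a,
      ← cfc_add a _ _ (by fun_prop) (by fun_prop),
      ← cfc_mul g _ a (by fun_prop) (by fun_prop)]
    refine cfc_congr fun s _ ↦ ?_
    simp only [g, Pi.one_apply, smul_eq_mul]
    exact div_mul_cancel₀ _ (hpos s).ne'
  have hz : z + (t : ℂ) • cfc f a • z = (1 + (t : ℂ) • cfc f a) • z := by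
    rw [add_smul, one_smul, smul_assoc]
  calc (1 + t) * ‖cfc f a • z‖ = ‖(((1 + t : ℝ) : ℂ) • cfc f a) • z‖ := by
        rw [smul_assoc, norm_smul ((1 + t : ℝ) : ℂ), Complex.norm_real,
          Real.norm_of_nonneg (by positivity)]
    _ = ‖cfc g a • (z + (t : ℂ) • cfc f a • z)‖ := by rw [← hmul, mul_smul, hz]
    _ ≤ ‖cfc g a‖ * ‖z + (t : ℂ) • cfc f a • z‖ := hsmul _ _
    _ ≤ ‖z + (t : ℂ) • cfc f a • z‖ := mul_le_of_le_one_left (norm_nonneg _) hg1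

/-- A contractive projection onto a submodule preserves annihilation by `f(a)`. -/
theorem cfc_smul_apply_eq_zero (hsmul : ∀ (a : A) (x : X), ‖a • x‖ ≤ ‖a‖ * ‖x‖)
    (horth : ∀ (b : A) (x z : X), IsSelfAdjoint b → b • x = 0 →
      ‖x + b • z‖ ^ 2 ≤ ‖x‖ ^ 2 + ‖b • z‖ ^ 2)
    (Φ : X →ₗ[ℂ] X) (hcontr : ∀ x, ‖Φ x‖ ≤ ‖x‖) (hfix : ∀ (a : A) (x : X), Φ (a • Φ x) = a • Φ x)
    (a : A) (ha : IsSelfAdjoint a) (f : ℝ → ℝ) (hf : Continuous f)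
    (hf01 : ∀ s, f s ∈ Set.Icc (0 : ℝ) 1) (x : X) (hx : cfc f a • x = 0) :
    cfc f a • Φ x = 0 := by
  have key (t : ℝ) (ht : 0 ≤ t) : (1 + 2 * t) * ‖cfc f a • Φ x‖ ^ 2 ≤ ‖x‖ ^ 2 := by
    have h1 := one_add_mul_norm_cfc_smul_le hsmul a ha f hf hf01 t ht (Φ x)
    have h2 := hcontr (x + (t : ℂ) • cfc f a • Φ x)
    rw [map_add, map_smul, hfix] at h2
    have h3 := horth (cfc f a) x ((t : ℂ) • Φ x) (cfc_predicate f a) hx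
    rw [smul_algebra_smul_comm, norm_smul, Complex.norm_real, Real.norm_of_nonneg ht] at h3
    have h4 := pow_le_pow_left₀ (by positivity) (h1.trans h2) 2
    nlinarith
  by_contra hne
  have hn : 0 < ‖cfc f a • Φ x‖ ^ 2 := by have := norm_pos_iff.2 hne; positivity
  have h := key (‖x‖ ^ 2 / ‖cfc f a • Φ x‖ ^ 2) (by positivity)
  have h' : ‖x‖ ^ 2 / ‖cfc f a • Φ x‖ ^ 2 * ‖cfc f a • Φ x‖ ^ 2 = ‖x‖ ^ 2 :=
    div_mul_cancel₀ _ hn.ne'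
  nlinarith [sq_nonneg ‖x‖]

/-- The truncation of `s` to the unit interval. -/
noncomputable def unitClamp (s : ℝ) : ℝ := max 0 (min 1 s)

theorem continuous_unitClamp : Continuous unitClamp := by
  unfold unitClamp; fun_prop

theorem unitClamp_mem (s : ℝ) : unitClamp s ∈ Set.Icc (0 : ℝ) 1 := by
  unfold unitClamp; constructor <;> grind

theorem unitClamp_of_mem {s : ℝ} (hs : s ∈ Set.Icc (0 : ℝ) 1) : unitClamp s = s := by
  obtain ⟨h0, h1⟩ := hs
  unfold unitClamp; grind

theorem unitClamp_add_add {s : ℝ} (hs : s ∈ Set.Icc (0 : ℝ) 1) :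
    unitClamp (3 * s) + unitClamp (3 * s - 1) + unitClamp (3 * s - 2) = s + s + s := by
  obtain ⟨h0, h1⟩ := hs
  unfold unitClamp; grind

theorem unitClamp_sub_one_mul (s : ℝ) : unitClamp s * unitClamp (s - 1) = unitClamp (s - 1) := by
  rcases le_total s 1 with h | h
  · have : unitClamp (s - 1) = 0 := by unfold unitClamp; grind
    simp [this]
  · have : unitClamp s = 1 := by unfold unitClamp; grind
    simp [this]

/-- A uniform bound `κ` on the commutators `[f(a), Φ]`, `0 ≤ f ≤ 1`, can be improved to `5κ/6`. -/
theorem commutator_bound_improve (hsmul : ∀ (a : A) (x : X), ‖a • x‖ ≤ ‖a‖ * ‖x‖)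
    (horth : ∀ (b : A) (x z : X), IsSelfAdjoint b → b • x = 0 →
      ‖x + b • z‖ ^ 2 ≤ ‖x‖ ^ 2 + ‖b • z‖ ^ 2)
    (Φ : X →ₗ[ℂ] X) (hcontr : ∀ x, ‖Φ x‖ ≤ ‖x‖) (hfix : ∀ (a : A) (x : X), Φ (a • Φ x) = a • Φ x)
    (a : A) (ha : IsSelfAdjoint a) (x : X) {κ : ℝ} (hκ0 : 0 ≤ κ)
    (hκ : ∀ f : ℝ → ℝ, Continuous f → (∀ s, f s ∈ Set.Icc (0 : ℝ) 1) →
      ‖cfc f a • Φ x - Φ (cfc f a • x)‖ ≤ κ)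
    (f : ℝ → ℝ) (hf : Continuous f) (hf01 : ∀ s, f s ∈ Set.Icc (0 : ℝ) 1) :
    ‖cfc f a • Φ x - Φ (cfc f a • x)‖ ≤ 5 / 6 * κ := by
  have hc := continuous_unitClamp
  set c₀ : ℝ → ℝ := fun s ↦ unitClamp (3 * f s) with hc₀
  set c₁ : ℝ → ℝ := fun s ↦ unitClamp (3 * f s - 1) with hc₁
  set c₂ : ℝ → ℝ := fun s ↦ unitClamp (3 * f s - 2) with hc₂
  have k₀ : Continuous c₀ := by fun_prop
  have k₁ : Continuous c₁ := by fun_prop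
  have k₂ : Continuous c₂ := by fun_prop
  have m₀ (s) : c₀ s ∈ Set.Icc (0 : ℝ) 1 := unitClamp_mem _
  have m₁ (s) : c₁ s ∈ Set.Icc (0 : ℝ) 1 := unitClamp_mem _
  have m₂ (s) : c₂ s ∈ Set.Icc (0 : ℝ) 1 := unitClamp_mem _
  have hsum : cfc c₀ a + cfc c₁ a + cfc c₂ a = cfc f a + cfc f a + cfc f a := by
    rw [← cfc_add a c₀ c₁ (by fun_prop) (by fun_prop),
      ← cfc_add a _ c₂ (by fun_prop) (by fun_prop), ← cfc_add a f f (by fun_prop) (by fun_prop),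
      ← cfc_add a _ f (by fun_prop) (by fun_prop)]
    exact cfc_congr fun s _ ↦ unitClamp_add_add (hf01 s)
  have h10 : cfc c₁ a * cfc c₀ a = cfc c₁ a := by
    rw [← cfc_mul c₁ c₀ a (by fun_prop) (by fun_prop)]
    refine cfc_congr fun s _ ↦ ?_
    simp only [hc₀, hc₁]
    rw [mul_comm, unitClamp_sub_one_mul]
  have h12 : cfc c₁ a * cfc c₂ a = cfc c₂ a := by
    rw [← cfc_mul c₁ c₂ a (by fun_prop) (by fun_prop)]
    refine cfc_congr fun s _ ↦ ?_
    have := unitClamp_sub_one_mul (3 * f s - 1)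
    rwa [sub_sub, one_add_one_eq_two] at this
  have hone : cfc (fun s ↦ 1 - c₁ s) a = 1 - cfc c₁ a := by
    rw [cfc_sub (fun _ ↦ (1 : ℝ)) c₁ a (by fun_prop) (by fun_prop), cfc_const_one ℝ a]
  have e₁ : cfc c₁ a • Φ x = cfc c₁ a • Φ (cfc c₀ a • x) := by
    have := cfc_smul_apply_eq_zero hsmul horth Φ hcontr hfix a ha c₁ k₁ m₁ (x - cfc c₀ a • x)
      (by rw [smul_sub, smul_smul, h10, sub_self])
    rwa [map_sub, smul_sub, sub_eq_zero] at this
  have e₂ : cfc c₁ a • Φ (cfc c₂ a • x) = Φ (cfc c₂ a • x) := by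
    have := cfc_smul_apply_eq_zero hsmul horth Φ hcontr hfix a ha (fun s ↦ 1 - c₁ s)
      (by fun_prop) (fun s ↦ ⟨by linarith [(m₁ s).2], by linarith [(m₁ s).1]⟩) (cfc c₂ a • x)
      (by rw [hone, sub_smul, one_smul, smul_smul, h12, sub_self])
    rw [hone, sub_smul, one_smul, sub_eq_zero] at this
    exact this.symm
  set y₀ := cfc c₀ a • Φ x - Φ (cfc c₀ a • x) with hy₀
  set y₁ := cfc c₁ a • Φ x - Φ (cfc c₁ a • x) with hy₁
  set y₂ := cfc c₂ a • Φ x - Φ (cfc c₂ a • x) with hy₂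
  have b₀ : ‖y₀‖ ≤ κ := hκ c₀ k₀ m₀
  have b₁ : ‖y₁‖ ≤ κ := hκ c₁ k₁ m₁
  have b₂ : ‖y₂‖ ≤ κ := hκ c₂ k₂ m₂
  have z₀ : cfc c₁ a • y₀ = 0 := by rw [hy₀, smul_sub, smul_smul, h10, e₁, sub_self]
  have z₂ : cfc c₁ a • y₂ = y₂ := by rw [hy₂, smul_sub, smul_smul, h12, e₂]
  have hpy := horth (cfc c₁ a) y₀ y₂ (cfc_predicate c₁ a) z₀
  rw [z₂] at hpy
  have h02 : ‖y₀ + y₂‖ ≤ 3 / 2 * κ := by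
    refine le_of_sq_le_sq ?_ (by positivity)
    nlinarith [norm_nonneg y₀, norm_nonneg y₂]
  have hD : (3 : ℂ) • (cfc f a • Φ x - Φ (cfc f a • x)) = (y₀ + y₂) + y₁ := by
    have h1 := congrArg (· • Φ x) hsum
    have h2 := congrArg (fun b ↦ Φ (b • x)) hsum
    simp only [add_smul, map_add] at h1 h2
    have h3 : (3 : ℂ) • (cfc f a • Φ x - Φ (cfc f a • x))
        = (cfc f a • Φ x + cfc f a • Φ x + cfc f a • Φ x)
          - (Φ (cfc f a • x) + Φ (cfc f a • x) + Φ (cfc f a • x)) := by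
      generalize cfc f a • Φ x = u
      module
    rw [h3, ← h1, ← h2, hy₀, hy₁, hy₂]
    abel
  have hn := congrArg norm hD
  rw [norm_smul, Complex.norm_ofNat] at hn
  linarith [norm_add_le (y₀ + y₂) y₁]

/-- A contractive projection onto a submodule commutes with `f(a)` whenever `0 ≤ f ≤ 1`. -/
theorem apply_cfc_smul (hsmul : ∀ (a : A) (x : X), ‖a • x‖ ≤ ‖a‖ * ‖x‖)
    (horth : ∀ (b : A) (x z : X), IsSelfAdjoint b → b • x = 0 →
      ‖x + b • z‖ ^ 2 ≤ ‖x‖ ^ 2 + ‖b • z‖ ^ 2)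
    (Φ : X →ₗ[ℂ] X) (hcontr : ∀ x, ‖Φ x‖ ≤ ‖x‖) (hfix : ∀ (a : A) (x : X), Φ (a • Φ x) = a • Φ x)
    (a : A) (ha : IsSelfAdjoint a) (x : X)
    (f : ℝ → ℝ) (hf : Continuous f) (hf01 : ∀ s, f s ∈ Set.Icc (0 : ℝ) 1) :
    Φ (cfc f a • x) = cfc f a • Φ x := by
  have key (n : ℕ) : ∀ f : ℝ → ℝ, Continuous f → (∀ s, f s ∈ Set.Icc (0 : ℝ) 1) →
      ‖cfc f a • Φ x - Φ (cfc f a • x)‖ ≤ (5 / 6) ^ n * (2 * ‖x‖) := by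
    induction n with
    | zero =>
      intro f hf hf01
      have h1 : ‖cfc f a‖ ≤ 1 := norm_cfc_le zero_le_one fun s _ ↦ by
        rw [Real.norm_of_nonneg (hf01 s).1]; exact (hf01 s).2
      have h2 : ‖cfc f a • Φ x‖ ≤ ‖x‖ :=
        ((hsmul _ _).trans (mul_le_of_le_one_left (norm_nonneg _) h1)).trans (hcontr x)
      have h3 : ‖Φ (cfc f a • x)‖ ≤ ‖x‖ :=
        (hcontr _).trans ((hsmul _ _).trans (mul_le_of_le_one_left (norm_nonneg _) h1))
      linarith [norm_sub_le (cfc f a • Φ x) (Φ (cfc f a • x))]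
    | succ n ih =>
      intro f hf hf01
      rw [pow_succ', mul_assoc]
      exact commutator_bound_improve hsmul horth Φ hcontr hfix a ha x (by positivity) ih f hf hf01
  have hlim : Filter.Tendsto (fun n : ℕ ↦ (5 / 6 : ℝ) ^ n * (2 * ‖x‖)) Filter.atTop (nhds 0) := by
    simpa using (tendsto_pow_atTop_nhds_zero_of_lt_one (r := (5 / 6 : ℝ)) (by norm_num)
      (by norm_num)).mul_const (2 * ‖x‖)
  have h0 := ge_of_tendsto' hlim fun n ↦ key n f hf hf01
  exact (sub_eq_zero.1 (norm_le_zero_iff.1 h0)).symm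

theorem apply_smul_of_isSelfAdjoint (hsmul : ∀ (a : A) (x : X), ‖a • x‖ ≤ ‖a‖ * ‖x‖)
    (horth : ∀ (b : A) (x z : X), IsSelfAdjoint b → b • x = 0 →
      ‖x + b • z‖ ^ 2 ≤ ‖x‖ ^ 2 + ‖b • z‖ ^ 2)
    (Φ : X →ₗ[ℂ] X) (hcontr : ∀ x, ‖Φ x‖ ≤ ‖x‖) (hfix : ∀ (a : A) (x : X), Φ (a • Φ x) = a • Φ x)
    (a : A) (ha : IsSelfAdjoint a) (x : X) : Φ (a • x) = a • Φ x := by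
  have hc := continuous_unitClamp
  set M : ℝ := ‖a‖ * ‖(1 : A)‖ + 1
  have hM : 0 < M := by positivity
  set f : ℝ → ℝ := fun s ↦ unitClamp ((s + M) / (2 * M))
  have hf : Continuous f := by fun_prop
  have hcfc : a = ((2 * M : ℝ) : ℂ) • cfc f a - (M : ℂ) • 1 := by
    rw [Complex.coe_smul, Complex.coe_smul, ← cfc_smul (2 * M) f a (by fun_prop),
      ← cfc_one ℝ a, ← cfc_smul M 1 a (by fun_prop),
      ← cfc_sub _ _ a (by fun_prop) (by fun_prop)]
    nth_rewrite 1 [← cfc_id ℝ a]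
    refine cfc_congr fun s hs ↦ ?_
    have hs' : |s| ≤ ‖a‖ * ‖(1 : A)‖ := spectrum.norm_le_norm_mul_of_mem hs
    obtain ⟨h1, h2⟩ := abs_le.1 hs'
    have : f s = (s + M) / (2 * M) := unitClamp_of_mem
      ⟨div_nonneg (by linarith) (by positivity), (div_le_one (by positivity)).2 (by linarith)⟩
    simp only [this, smul_eq_mul, Pi.one_apply, id]
    field_simp
    ring
  have h := apply_cfc_smul hsmul horth Φ hcontr hfix a ha x f hf fun s ↦ unitClamp_mem _
  have e (w : X) : a • w = ((2 * M : ℝ) : ℂ) • cfc f a • w - (M : ℂ) • w := by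
    conv_lhs => rw [hcfc]
    rw [sub_smul, smul_assoc, smul_assoc, one_smul]
  rw [e, e, map_sub, Φ.map_smul, Φ.map_smul, h]

/-- A contractive projection onto a submodule of a module satisfying the Pythagorean inequality
`horth` is a module map. -/
theorem apply_smul_of_contractive_projection (hsmul : ∀ (a : A) (x : X), ‖a • x‖ ≤ ‖a‖ * ‖x‖)
    (horth : ∀ (b : A) (x z : X), IsSelfAdjoint b → b • x = 0 →
      ‖x + b • z‖ ^ 2 ≤ ‖x‖ ^ 2 + ‖b • z‖ ^ 2)
    (Φ : X →ₗ[ℂ] X) (hcontr : ∀ x, ‖Φ x‖ ≤ ‖x‖) (hfix : ∀ (a : A) (x : X), Φ (a • Φ x) = a • Φ x)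
    (a : A) (x : X) : Φ (a • x) = a • Φ x := by
  have hsa (b : selfAdjoint A) : Φ ((b : A) • x) = (b : A) • Φ x :=
    apply_smul_of_isSelfAdjoint hsmul horth Φ hcontr hfix b b.2 x
  rw [← realPart_add_I_smul_imaginaryPart a]
  simp only [add_smul, smul_assoc, map_add, map_smul, hsa]

end CommutingProjection

theorem norm_add_sq_le_of_star_mul_eq_zero {B : Type*} [NonUnitalNormedRing B] [StarRing B]
    [CStarRing B] {u v : B} (h : star u * v = 0) : ‖u + v‖ ^ 2 ≤ ‖u‖ ^ 2 + ‖v‖ ^ 2 := by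
  have h' : star v * u = 0 := by simpa using congrArg star h
  have : star (u + v) * (u + v) = star u * u + star v * v := by
    rw [star_add, add_mul, mul_add, mul_add, h, h', add_zero, zero_add]
  rw [sq, sq, sq, ← CStarRing.norm_star_mul_self, this, ← CStarRing.norm_star_mul_self,
    ← CStarRing.norm_star_mul_self]
  exact norm_add_le _ _


/-- Let `H` be a complex Hilbert space, `A` a norm-closed `*`-subalgebra of
`B(H)`, and `X` a norm-closed subspace of `B(H)` with `A X ⊆ X` which is nondegenerate
(the span of products `a x` is norm-dense in `X`).  If `Y ⊆ X` is a norm-closed `A`-invariant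
subspace and `Φ : X → X` is a linear contractive idempotent with range `Y`, then `Φ` is an
`A`-module map: `Φ (a x) = a Φ x` for all `a ∈ A`, `x ∈ X`. -/
theorem projection_onto_submodule_is_module_map
    {H : Type*} [NormedAddCommGroup H] [InnerProductSpace ℂ H] [CompleteSpace H]
    (A : StarSubalgebra ℂ (H →L[ℂ] H)) (hA : IsClosed (A : Set (H →L[ℂ] H)))
    (X : Submodule ℂ (H →L[ℂ] H)) (hXcl : IsClosed (X : Set (H →L[ℂ] H)))
    (hAX : ∀ a ∈ A, ∀ x ∈ X, a * x ∈ X)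
    (hnd : (X : Set (H →L[ℂ] H)) ⊆
      closure (Submodule.span ℂ {z : H →L[ℂ] H | ∃ a ∈ A, ∃ x ∈ X, z = a * x} :
        Set (H →L[ℂ] H)))
    (Y : Submodule ℂ (H →L[ℂ] H)) (hYX : Y ≤ X) (hYcl : IsClosed (Y : Set (H →L[ℂ] H)))
    (hAY : ∀ a ∈ A, ∀ y ∈ Y, a * y ∈ Y)
    (Φ : X →ₗ[ℂ] X)
    (hΦcontr : ∀ x : X, ‖Φ x‖ ≤ ‖x‖)
    (hΦidem : ∀ x : X, Φ (Φ x) = Φ x)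
    (hΦintoY : ∀ x : X, ((Φ x : H →L[ℂ] H) ∈ Y))
    (hΦontoY : ∀ y ∈ Y, ∃ x : X, (Φ x : H →L[ℂ] H) = y)
    (a : H →L[ℂ] H) (ha : a ∈ A) (x : X) (hax : a * (x : H →L[ℂ] H) ∈ X) :
    (Φ ⟨a * (x : H →L[ℂ] H), hax⟩ : H →L[ℂ] H) = a * (Φ x : H →L[ℂ] H) := by
  have : IsClosed (A : Set (H →L[ℂ] H)) := hA
  let : CStarAlgebra A := StarSubalgebra.cstarAlgebra A
  let : Module A X :=
    { smul := fun b y ↦ ⟨b * y, hAX b b.2 y y.2⟩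
      one_smul := fun y ↦ Subtype.ext (one_mul (y : H →L[ℂ] H))
      mul_smul := fun b c y ↦ Subtype.ext (mul_assoc (b : H →L[ℂ] H) c y)
      smul_zero := fun b ↦ Subtype.ext (mul_zero (b : H →L[ℂ] H))
      smul_add := fun b y z ↦ Subtype.ext (mul_add (b : H →L[ℂ] H) y z)
      add_smul := fun b c y ↦ Subtype.ext (add_mul (b : H →L[ℂ] H) c y)
      zero_smul := fun y ↦ Subtype.ext (zero_mul (y : H →L[ℂ] H)) }
  have hcoe (b : A) (y : X) : ((b • y : X) : H →L[ℂ] H) = b * y := rfl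
  have : IsScalarTower ℂ A X :=
    ⟨fun r b y ↦ Subtype.ext (smul_mul_assoc r (b : H →L[ℂ] H) (y : H →L[ℂ] H))⟩
  have hfix (b : A) (y : X) : Φ (b • Φ y) = b • Φ y := by
    obtain ⟨w, hw⟩ := hΦontoY _ (hAY b b.2 _ (hΦintoY y))
    have hw' : Φ w = b • Φ y := Subtype.ext hw
    rw [← hw', hΦidem]
  have h := apply_smul_of_contractive_projection (A := A) (X := X)
    (fun b y ↦ norm_mul_le (b : H →L[ℂ] H) (y : H →L[ℂ] H))
    (fun b y z hb hy ↦ by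
      refine norm_add_sq_le_of_star_mul_eq_zero (u := (y : H →L[ℂ] H)) ?_
      have hb' : star (b : H →L[ℂ] H) = b := congrArg Subtype.val hb.star_eq
      have hy' : (b : H →L[ℂ] H) * y = 0 := congrArg Subtype.val hy
      rw [hcoe, ← mul_assoc, ← hb', ← star_mul, hy', star_zero, zero_mul])
    Φ hΦcontr hfix ⟨a, ha⟩ x
  exact congrArg Subtype.val h
end

section
/- Let g, r : [0,1] → ℝ be bounded Borel measurable functions. Suppose that for every continuous function h : [0,1] → ℝ such that the set {t ∈ [0,1] : g(t) < h(t)} is meager, the set {t ∈ [0,1] : r(t) < h(t)} is also meager. Then the set {t ∈ [0,1] : r(t) < g(t)} is meager. (Equivalently: in the Dixmier algebra of bounded Borel functions on [0,1] modulo functions vanishing off a meager set, every selfadjoint element k is the least upper bound of the continuous functions h on [0,1] with h ≤ k.) -/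
open Set TopologicalSpace in
/-- If `g` is bounded below by `m ≤ q` and is larger than `q` on a comeagre part of the open set
`U`, then every upper bound `r` of the continuous functions below `g` is at least `q` on a
comeagre part of `U`. -/
lemma isMeagre_inter_lt_of_isOpen {X : Type*} [TopologicalSpace X] [MetrizableSpace X]
    {g r : X → ℝ} {U : Set X} {m q : ℝ} (hU : IsOpen U) (hmq : m ≤ q) (hm : ∀ t, m ≤ g t)
    (hgU : IsMeagre (U \ {t | q < g t}))
    (hub : ∀ h : X → ℝ, Continuous h → IsMeagre {t | g t < h t} → IsMeagre {t | r t < h t}) :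
    IsMeagre (U ∩ {t | r t < q}) := by
  let _ := metrizableSpaceMetric X
  obtain ⟨F, hFc, hFU, hF, -⟩ := hU.exists_iUnion_isClosed
  have key (n : ℕ) : IsMeagre (F n ∩ {t | r t < q}) := by
    have hd : Disjoint Uᶜ (F n) := disjoint_compl_left_iff_subset.2 (hFU n)
    obtain ⟨φ, hφ0, hφ1, hφ⟩ :=
      exists_continuous_zero_one_of_isClosed hU.isClosed_compl (hFc n) hd
    refine (hub (fun t => m + (q - m) * φ t) (by fun_prop) (hgU.mono ?_)).mono ?_
    · intro t ht
      simp only [mem_ofPred_eq] at ht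
      refine ⟨by_contra fun htU => ?_, fun htq => ?_⟩
      · have h0 : φ t = 0 := hφ0 htU
        rw [h0] at ht
        linarith [hm t]
      · simp only [mem_ofPred_eq] at htq
        nlinarith [(hφ t).2]
    · rintro t ⟨htF, htr⟩
      have h1 : φ t = 1 := hφ1 htF
      simpa [h1] using htr
  rw [← hF, iUnion_inter]
  exact isMeagre_iUnion key

/-- Let `g, r : [0,1] → ℝ` be bounded Borel functions.  If for every
continuous `h : [0,1] → ℝ` with `{g < h}` meager the set `{r < h}` is also meager, then
`{r < g}` is meager.  (In the Dixmier algebra of bounded Borel functions on `[0,1]` modulo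
functions vanishing off a meager set, every selfadjoint element is the least upper bound of
the continuous functions below it.) -/
theorem dixmier_algebra_lub_of_continuous
    (g r : Set.Icc (0 : ℝ) 1 → ℝ)
    (hgmeas : Measurable g) (hrmeas : Measurable r)
    (hgbdd : ∃ C : ℝ, ∀ t, |g t| ≤ C) (hrbdd : ∃ C : ℝ, ∀ t, |r t| ≤ C)
    (hub : ∀ h : Set.Icc (0 : ℝ) 1 → ℝ, Continuous h →
      IsMeagre {t | g t < h t} → IsMeagre {t | r t < h t}) :
    IsMeagre {t | r t < g t} := by
  obtain ⟨C, hC⟩ := hgbdd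
  have key (q : ℚ) : IsMeagre {t | r t < q ∧ q < g t} := by
    obtain ⟨U, hU, hAU⟩ :=
      (measurableSet_lt (measurable_const (a := (q : ℝ))) hgmeas).residualEq_isOpen
    have hiff := Filter.eventuallyEq_set.1 hAU
    have hUA : IsMeagre (U \ {t | (q : ℝ) < g t}) := by
      filter_upwards [hiff] with t ht h
      exact h.2 (ht.2 h.1)
    have hAU' : IsMeagre ({t | (q : ℝ) < g t} \ U) := by
      filter_upwards [hiff] with t ht h
      exact h.2 (ht.1 h.1)
    have hUr : IsMeagre (U ∩ {t | r t < q}) :=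
      isMeagre_inter_lt_of_isOpen hU (min_le_left (q : ℝ) (-C))
        (fun t => (min_le_right _ _).trans (abs_le.1 (hC t)).1) hUA hub
    refine (hUr.union hAU').mono fun t ht => ?_
    by_cases htU : t ∈ U
    · exact Or.inl ⟨htU, ht.1⟩
    · exact Or.inr ⟨ht.2, htU⟩
  refine (isMeagre_iUnion key).mono fun t ht => ?_
  obtain ⟨q, hq⟩ := exists_rat_btwn (show r t < g t from ht)
  exact Set.mem_iUnion.2 ⟨q, hq⟩
end
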